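/- Let K be a field of characteristic zero and X a rank-two irreducible locally nilpotent K-derivation of K[x,y,z]. Write K[x,y,z]^X = K[u,p] where u is a coordinate of K[x,y,z], let s be a minimal local slice of X with X(s) = c(u), let c1 be a prime factor of c in K[u], and let h1 ∈ K[u,p,s] be monic in s with I_{c1}^X = (c1, h1). Then the ideal I_{c1}^X contains an element whose residue modulo c1 is a coordinate of the two-variable polynomial ring (K[u]/(c1))[p,s] if and only if the residue of h1 modulo c1 is a coordinate of (K[u]/(c1))[p,s]; moreover every h ∈ I_{c1}^X whose residue modulo c1 is a coordinate of (K[u]/(c1))[p,s] satisfies h ≡ μ·h1 mod c1 for some nonzero μ in the field K[u]/(c1). -/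

import Mathlib

set_option synthInstance.maxHeartbeats 1000000
set_option maxHeartbeats 1000000

noncomputable section

variable (K : Type) [Field K] [CharZero K]

abbrev PolyR (K : Type) [Field K] : Type := MvPolynomial (Fin 3) K

/-- A derivation is locally nilpotent if every element is killed by some iterate. -/
def LND (X : Derivation K (PolyR K) (PolyR K)) : Prop :=
  ∀ a : PolyR K, ∃ n : ℕ, 0 < n ∧ (⇑X)^[n] a = 0

/-- `X` is irreducible: every common divisor of `X x, X y, X z` is a unit. -/
def IrredDer (X : Derivation K (PolyR K) (PolyR K)) : Prop :=
  ∀ d : PolyR K, (∀ i : Fin 3, d ∣ X (MvPolynomial.X i)) → IsUnit d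

def IsCoord (f : PolyR K) : Prop :=
  ∃ g h : PolyR K, Algebra.adjoin K {f, g, h} = ⊤

def IsCoordSys (u v w : PolyR K) : Prop := Algebra.adjoin K {u, v, w} = ⊤

def IsSysOfCoords2 (u v : PolyR K) : Prop :=
  ∃ w : PolyR K, Algebra.adjoin K {u, v, w} = ⊤

/-- The corank of a derivation: the largest length of a system of coordinates in the kernel. -/
def corank (X : Derivation K (PolyR K) (PolyR K)) : ℕ :=
  sSup {r : ℕ | ∃ l : List (PolyR K), l.length = r ∧ (∀ f ∈ l, X f = 0) ∧
    ∃ m : List (PolyR K), (l ++ m).length = 3 ∧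
      Algebra.adjoin K {a : PolyR K | a ∈ l ++ m} = ⊤}

def rankD (X : Derivation K (PolyR K) (PolyR K)) : ℕ := 3 - corank K X

def IsLocalSlice (X : Derivation K (PolyR K) (PolyR K)) (s : PolyR K) : Prop :=
  X s ≠ 0 ∧ X (X s) = 0

def IsMinLocalSlice (X : Derivation K (PolyR K) (PolyR K)) (s : PolyR K) : Prop :=
  IsLocalSlice K X s ∧ ∀ v : PolyR K, IsLocalSlice K X v → X v ∣ X s →
    ∃ μ : (PolyR K)ˣ, X v = (μ : PolyR K) * X s

/-- `c` generates the plinth ideal `S^X = {X a : X² a = 0}` as an ideal of the constants. -/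
def IsPlinthGen (X : Derivation K (PolyR K) (PolyR K)) (c : PolyR K) : Prop :=
  {d : PolyR K | ∃ a : PolyR K, X a = d ∧ X (X a) = 0} =
    {d : PolyR K | ∃ r : PolyR K, X r = 0 ∧ d = r * c}

/-- `X` is triangulable: triangular in some coordinate system. -/
def Triangulable (X : Derivation K (PolyR K) (PolyR K)) : Prop :=
  ∃ u v w : PolyR K, IsCoordSys K u v w ∧
    X u ∈ (⊥ : Subalgebra K (PolyR K)) ∧
    X v ∈ Algebra.adjoin K {u} ∧
    X w ∈ Algebra.adjoin K {u, v}

/-- Evaluation of `Q ∈ K[u][T]` at `T = t`, with coefficients evaluated at `u`. -/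
def ev2 (u t : PolyR K) (Q : Polynomial (Polynomial K)) : PolyR K :=
  Polynomial.eval₂ (Polynomial.aeval u).toRingHom t Q

/-- The Jacobian derivation `Jac(f,g,·)` applied to `h`. -/
def jacDet (f g h : PolyR K) : PolyR K :=
  Matrix.det !![MvPolynomial.pderiv 0 f, MvPolynomial.pderiv 1 f, MvPolynomial.pderiv 2 f;
    MvPolynomial.pderiv 0 g, MvPolynomial.pderiv 1 g, MvPolynomial.pderiv 2 g;
    MvPolynomial.pderiv 0 h, MvPolynomial.pderiv 1 h, MvPolynomial.pderiv 2 h]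


/-- `f` is a coordinate of `(K[u]/(c₁))[p,s]`, modelled inside the quotient
`K[u,p,s]/(c₁)`: there is `g` with `B[f,g] = B[p̄,s̄]` where `B = K[ū]`. -/
def IsResidualCoord {K : Type} [Field K] [CharZero K] {u p s : PolyR K}
    (c1T uT pT sT : Algebra.adjoin K {u, p, s})
    (f : ↥(Algebra.adjoin K {u, p, s}) ⧸ Ideal.span {c1T}) : Prop :=
  ∃ g : ↥(Algebra.adjoin K {u, p, s}) ⧸ Ideal.span {c1T},
    Algebra.adjoin K {Ideal.Quotient.mk (Ideal.span {c1T}) uT, f, g} =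
      Algebra.adjoin K {Ideal.Quotient.mk (Ideal.span {c1T}) uT,
        Ideal.Quotient.mk (Ideal.span {c1T}) pT,
        Ideal.Quotient.mk (Ideal.span {c1T}) sT}

/-- Elements of `K[u,p,s]` can be integrated after multiplication by `X s`. -/
lemma integrate_aux {K : Type} [Field K] [CharZero K]
    (X : Derivation K (PolyR K) (PolyR K)) (A : Subalgebra K (PolyR K))
    (hA : ∀ a ∈ A, X a = 0) (s : PolyR K) (q : Polynomial A) :
    ∃ q' : Polynomial A, X (Polynomial.eval₂ (A.val : A →+* PolyR K) s q') =
      X s * Polynomial.eval₂ (A.val : A →+* PolyR K) s q := by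
  induction q using Polynomial.induction_on' with
  | add q r hq hr =>
    obtain ⟨q', hq'⟩ := hq
    obtain ⟨r', hr'⟩ := hr
    refine ⟨q' + r', ?_⟩
    rw [Polynomial.eval₂_add, Polynomial.eval₂_add, map_add, hq', hr', mul_add]
  | monomial n b =>
    refine ⟨Polynomial.monomial (n+1) (((n+1 : K)⁻¹) • b), ?_⟩
    have hb : X (b : PolyR K) = 0 := hA b b.2
    have hn : (n + 1 : K) ≠ 0 := by exact_mod_cast Nat.succ_ne_zero n
    have hb' : X ((((n+1 : K)⁻¹) • b : A) : PolyR K) = 0 := hA _ (Subtype.mem _)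
    have hcoe : ((((n+1 : K)⁻¹) • b : A) : PolyR K) = ((n+1 : K)⁻¹) • (b : PolyR K) := rfl
    simp only [Polynomial.eval₂_monomial, RingHom.coe_coe, Subalgebra.coe_val,
      Derivation.leibniz, Derivation.leibniz_pow, hb']
    rw [hcoe]
    simp only [smul_zero, add_zero, nsmul_eq_mul, smul_eq_mul, Nat.add_sub_cancel]
    rw [show (((n+1:ℕ) : PolyR K)) = algebraMap K (PolyR K) (n+1 : K) by simp]
    rw [Algebra.smul_def]
    have : algebraMap K (PolyR K) (n+1 : K)⁻¹ * algebraMap K (PolyR K) (n+1 : K) = 1 := by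
      rw [← map_mul, inv_mul_cancel₀ hn, map_one]
    linear_combination (X s * (b : PolyR K) * s ^ n) * this

lemma adjoin_poly {K : Type} [Field K] (u p s : PolyR K) (t : PolyR K) :
    t ∈ Algebra.adjoin K {u, p, s} ↔ ∃ q : Polynomial (Algebra.adjoin K {u, p}),
      t = Polynomial.eval₂ ((Algebra.adjoin K {u, p}).val : _ →+* PolyR K) s q := by
  have hle : Algebra.adjoin K {u, p} ≤ Algebra.adjoin K {u, p, s} := by
    apply Algebra.adjoin_mono
    intro x hx
    rcases hx with rfl | rfl <;> simp
  constructor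
  · intro ht
    induction ht using Algebra.adjoin_induction with
    | mem x hx =>
      rcases hx with rfl | rfl | rfl
      · exact ⟨Polynomial.C ⟨x, Algebra.subset_adjoin (by simp)⟩, by simp⟩
      · exact ⟨Polynomial.C ⟨x, Algebra.subset_adjoin (by simp)⟩, by simp⟩
      · exact ⟨Polynomial.X, by simp⟩
    | algebraMap r => exact ⟨Polynomial.C (algebraMap _ _ r), by simp⟩
    | add x y _ _ hx hy =>
      obtain ⟨q, rfl⟩ := hx
      obtain ⟨r, rfl⟩ := hy
      exact ⟨q + r, by rw [Polynomial.eval₂_add]⟩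
    | mul x y _ _ hx hy =>
      obtain ⟨q, rfl⟩ := hx
      obtain ⟨r, rfl⟩ := hy
      exact ⟨q * r, by rw [Polynomial.eval₂_mul]⟩
  · rintro ⟨q, rfl⟩
    rw [Polynomial.eval₂_eq_sum_range]
    refine Subalgebra.sum_mem _ fun i _ => Subalgebra.mul_mem _ (hle (q.coeff i).2)
      (Subalgebra.pow_mem _ (Algebra.subset_adjoin (by simp)) _)

/-- The slice lemma: a power of `X s` times any element lies in `K[u,p,s]`. -/
lemma slice_aux {K : Type} [Field K] [CharZero K]
    (X : Derivation K (PolyR K) (PolyR K)) (u p s : PolyR K)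
    (hker : {a : PolyR K | X a = 0} = (Algebra.adjoin K {u, p} : Subalgebra K (PolyR K)))
    (hs : X (X s) = 0) (n : ℕ) :
    ∀ a : PolyR K, (⇑X)^[n] a = 0 → ∃ m : ℕ, X s ^ m * a ∈ Algebra.adjoin K {u, p, s} := by
  have hk : ∀ a, X a = 0 ↔ a ∈ Algebra.adjoin K {u, p} := fun a => by
    have := Set.ext_iff.1 hker a
    simpa using this
  have hle : Algebra.adjoin K {u, p} ≤ Algebra.adjoin K {u, p, s} := by
    apply Algebra.adjoin_mono
    intro x hx
    rcases hx with rfl | rfl <;> simp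
  induction n with
  | zero =>
    intro a ha
    refine ⟨0, ?_⟩
    simp at ha
    simp [ha]
  | succ n ih =>
    intro a ha
    rw [Function.iterate_succ_apply] at ha
    obtain ⟨m, hm⟩ := ih _ ha
    obtain ⟨q, hq⟩ := (adjoin_poly u p s _).1 hm
    obtain ⟨q', hq'⟩ := integrate_aux X _ (fun a ha => (hk a).2 ha) s q
    rw [← hq] at hq'
    refine ⟨m + 1, ?_⟩
    have hpow : X (X s ^ (m+1)) = 0 := by
      rw [Derivation.leibniz_pow, hs]; simp
    have h0 : X (X s ^ (m+1) * a -
        Polynomial.eval₂ ((Algebra.adjoin K {u, p}).val : _ →+* PolyR K) s q') = 0 := by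
      rw [map_sub, hq', Derivation.leibniz, hpow]
      simp only [smul_eq_mul, mul_zero, add_zero]
      ring
    have h1 := hle ((hk _).1 h0)
    have h2 := (adjoin_poly u p s _).2 ⟨q', rfl⟩
    simpa using Subalgebra.add_mem _ h1 h2

lemma algIndep_aux {K : Type} [Field K] [CharZero K]
    (X : Derivation K (PolyR K) (PolyR K)) (hln : LND K X) (u p s : PolyR K)
    (hker : {a : PolyR K | X a = 0} = (Algebra.adjoin K {u, p} : Subalgebra K (PolyR K)))
    (hs : IsLocalSlice K X s) :
    AlgebraicIndependent K (fun o : Option (Fin 2) => o.elim u ![p, s]) := by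
  have hk : ∀ a, X a = 0 ↔ a ∈ Algebra.adjoin K {u, p} := fun a => by
    have := Set.ext_iff.1 hker a
    simpa using this
  have hle : Algebra.adjoin K {u, p} ≤ Algebra.adjoin K {u, p, s} := by
    apply Algebra.adjoin_mono
    intro x hx
    rcases hx with rfl | rfl <;> simp
  have hr : Set.range (fun o : Option (Fin 2) => o.elim u ![p, s]) = {u, p, s} := by
    ext x
    simp [Option.exists, Fin.exists_fin_two, eq_comm]
  have halg : Algebra.IsAlgebraic
      (Algebra.adjoin K (Set.range (fun o : Option (Fin 2) => o.elim u ![p, s]))) (PolyR K) := by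
    rw [hr]
    refine ⟨fun a => ?_⟩
    obtain ⟨n, _, hn⟩ := hln a
    obtain ⟨m, hm⟩ := slice_aux X u p s hker hs.2 n a hn
    have hc : X s ∈ Algebra.adjoin K {u, p, s} := hle ((hk _).1 hs.2)
    have hcm := Subalgebra.pow_mem _ hc m
    refine ⟨Polynomial.C ⟨_, hcm⟩ * Polynomial.X - Polynomial.C ⟨_, hm⟩, ?_, ?_⟩
    · intro h
      have := congrArg (fun q => Polynomial.coeff q 1) h
      simp at this
      have := congrArg Subtype.val this
      simp at this
      exact hs.1 this.1
    · simp [Subalgebra.algebraMap_def]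
  refine (Algebra.IsAlgebraic.isTranscendenceBasis_of_le_trdeg_of_finite K _ ?_).1
  rw [MvPolynomial.trdeg_of_isDomain]
  simp

/-- If `(f, g)` generate a polynomial ring in two variables over a domain, `f` is
irreducible. -/
lemma irred_aux {F : Type} [CommRing F] [IsDomain F]
    (f g : MvPolynomial (Fin 2) F)
    (h : Function.Surjective (MvPolynomial.aeval (R := F) ![f, g])) : Irreducible f := by
  have hinj : Function.Injective (MvPolynomial.aeval (R := F) ![f, g]) := by
    have htop : Algebra.adjoin F (Set.range ![f, g]) = ⊤ := by
      rw [Algebra.adjoin_range_eq_range_aeval]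
      exact AlgHom.range_eq_top _ |>.2 h
    have halg : Algebra.IsAlgebraic (Algebra.adjoin F (Set.range ![f, g]))
        (MvPolynomial (Fin 2) F) := by
      rw [htop]
      refine ⟨fun a => ?_⟩
      exact isAlgebraic_algebraMap (⟨a, Algebra.mem_top⟩ :
        (⊤ : Subalgebra F (MvPolynomial (Fin 2) F)))
    refine (Algebra.IsAlgebraic.isTranscendenceBasis_of_le_trdeg_of_finite F ![f, g] ?_).1
    rw [MvPolynomial.trdeg_of_isDomain]
    simp
  let e := AlgEquiv.ofBijective (MvPolynomial.aeval (R := F) ![f, g]) ⟨hinj, h⟩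
  have he : e (MvPolynomial.X 0) = f := by simp [e]
  rw [← he]
  exact (MulEquiv.irreducible_iff e).2 (MvPolynomial.X_prime (i := (0 : Fin 2))).irreducible

/-- The ring `K[u,p,s]` is a polynomial ring over `K[u]`. -/
lemma equiv_aux {K : Type} [Field K] (u p s : PolyR K)
    (hind : AlgebraicIndependent K (fun o : Option (Fin 2) => o.elim u ![p, s]))
    (uT pT sT : Algebra.adjoin K {u, p, s})
    (hu : (uT : PolyR K) = u) (hp : (pT : PolyR K) = p) (hs : (sT : PolyR K) = s) :
    Function.Bijective (MvPolynomial.eval₂Hom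
      ((Polynomial.aeval uT : Polynomial K →ₐ[K] _) : Polynomial K →+* _) ![pT, sT]) := by
  set Φ := MvPolynomial.eval₂Hom
      ((Polynomial.aeval uT : Polynomial K →ₐ[K] _) : Polynomial K →+* _) ![pT, sT] with hΦ
  constructor
  · have hcomp : ∀ q : MvPolynomial (Option (Fin 2)) K,
        ((Φ (MvPolynomial.optionEquivRight K (Fin 2) q) : Algebra.adjoin K {u, p, s}) : PolyR K)
          = MvPolynomial.aeval (fun o : Option (Fin 2) => o.elim u ![p, s]) q := by
      intro q
      induction q using MvPolynomial.induction_on with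
      | C r => simp [hΦ, MvPolynomial.optionEquivRight_C]
      | add a b ha hb => simp only [map_add, ← ha, ← hb]; rfl
      | mul_X a o ha =>
        rw [map_mul, map_mul, map_mul, ← ha]
        rcases o with _ | i
        · rw [MvPolynomial.optionEquivRight_X_none]
          simp [hΦ, hu]
        · rw [MvPolynomial.optionEquivRight_X_some]
          fin_cases i <;> simp [hΦ, hp, hs]
    intro a b hab
    obtain ⟨a, rfl⟩ := (MvPolynomial.optionEquivRight K (Fin 2)).surjective a
    obtain ⟨b, rfl⟩ := (MvPolynomial.optionEquivRight K (Fin 2)).surjective b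
    congr 1
    apply hind
    rw [← hcomp, ← hcomp, hab]
  · rintro ⟨t, ht⟩
    induction ht using Algebra.adjoin_induction with
    | mem x hx =>
      rcases hx with rfl | rfl | rfl
      · exact ⟨MvPolynomial.C Polynomial.X, Subtype.ext (by simp [hΦ, hu])⟩
      · exact ⟨MvPolynomial.X 0, Subtype.ext (by simp [hΦ, hp])⟩
      · exact ⟨MvPolynomial.X 1, Subtype.ext (by simp [hΦ, hs])⟩
    | algebraMap r => exact ⟨MvPolynomial.C (Polynomial.C r), Subtype.ext (by simp [hΦ])⟩
    | add x y _ _ hx hy =>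
      obtain ⟨q, hq⟩ := hx
      obtain ⟨r, hr⟩ := hy
      exact ⟨q + r, by rw [map_add, hq, hr]; rfl⟩
    | mul x y _ _ hx hy =>
      obtain ⟨q, hq⟩ := hx
      obtain ⟨r, hr⟩ := hy
      exact ⟨q * r, by rw [map_mul, hq, hr]; rfl⟩

/-- The residue ring `K[u,p,s]/(c₁)` is a polynomial ring over `K[u]/(c₁)`. -/
lemma residue_aux {K : Type} [Field K] (u p s : PolyR K)
    (hind : AlgebraicIndependent K (fun o : Option (Fin 2) => o.elim u ![p, s]))
    (uT pT sT c1T : Algebra.adjoin K {u, p, s})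
    (hu : (uT : PolyR K) = u) (hp : (pT : PolyR K) = p) (hs : (sT : PolyR K) = s)
    (c1 : Polynomial K) (hc : c1T = Polynomial.aeval uT c1) :
    ∃ ψ : MvPolynomial (Fin 2) (Polynomial K ⧸ Ideal.span {c1}) ≃+*
        (↥(Algebra.adjoin K {u, p, s}) ⧸ Ideal.span {c1T}),
      (∀ q : Polynomial K, ψ (MvPolynomial.C (Ideal.Quotient.mk _ q)) =
        Ideal.Quotient.mk _ (Polynomial.aeval uT q)) ∧
      ψ (MvPolynomial.X 0) = Ideal.Quotient.mk _ pT ∧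
      ψ (MvPolynomial.X 1) = Ideal.Quotient.mk _ sT := by
  let e := RingEquiv.ofBijective _ (equiv_aux u p s hind uT pT sT hu hp hs)
  have hI : Ideal.span {c1T} = Ideal.map (e : _ →+* _)
      (Ideal.map (MvPolynomial.C : _ →+* MvPolynomial (Fin 2) (Polynomial K))
        (Ideal.span {c1})) := by
    rw [Ideal.map_span, Ideal.map_span, Set.image_singleton, Set.image_singleton, hc]
    simp [e]
  let ψ := (MvPolynomial.quotientEquivQuotientMvPolynomial (σ := Fin 2)
    (Ideal.span {c1})).toRingEquiv.trans (Ideal.quotientEquiv _ _ e hI)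
  refine ⟨ψ, fun q => ?_, ?_, ?_⟩
  · have : MvPolynomial.quotientEquivQuotientMvPolynomial (σ := Fin 2)
      (Ideal.span {c1}) (MvPolynomial.C (Ideal.Quotient.mk _ q)) =
      Ideal.Quotient.mk _ (MvPolynomial.C q) := by
        simp [MvPolynomial.quotientEquivQuotientMvPolynomial]
    simp [ψ, this, e]
  · have : MvPolynomial.quotientEquivQuotientMvPolynomial (σ := Fin 2)
      (Ideal.span {c1}) (MvPolynomial.X 0) =
      Ideal.Quotient.mk _ (MvPolynomial.X 0) := by
        simp [MvPolynomial.quotientEquivQuotientMvPolynomial]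
    simp [ψ, this, e]
  · have : MvPolynomial.quotientEquivQuotientMvPolynomial (σ := Fin 2)
      (Ideal.span {c1}) (MvPolynomial.X 1) =
      Ideal.Quotient.mk _ (MvPolynomial.X 1) := by
        simp [MvPolynomial.quotientEquivQuotientMvPolynomial]
    simp [ψ, this, e]

/-- A residual coordinate is irreducible. -/
lemma resirred_aux {K F R : Type} [Field K] [CommRing F] [IsDomain F] [CommRing R] [Algebra K R]
    (ψ : MvPolynomial (Fin 2) F ≃+* R) (f g ub pb sb : R)
    (hK : ∀ r : K, ∃ a : F, ψ (MvPolynomial.C a) = algebraMap K R r)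
    (hU : ∃ a : F, ψ (MvPolynomial.C a) = ub)
    (hF : ∀ a : F, ψ (MvPolynomial.C a) ∈ Algebra.adjoin K {ub})
    (hp : ψ (MvPolynomial.X 0) = pb) (hs : ψ (MvPolynomial.X 1) = sb)
    (h : Algebra.adjoin K {ub, f, g} = Algebra.adjoin K {ub, pb, sb}) : Irreducible f := by
  have htop : ∀ m, ψ m ∈ Algebra.adjoin K {ub, f, g} := by
    intro m
    rw [h]
    induction m using MvPolynomial.induction_on with
    | C a => exact Algebra.adjoin_mono (by simp) (hF a)
    | add a b ha hb => rw [map_add]; exact Subalgebra.add_mem _ ha hb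
    | mul_X a i ha =>
      rw [map_mul]
      refine Subalgebra.mul_mem _ ha (Algebra.subset_adjoin ?_)
      fin_cases i
      · simp [hp]
      · simp [hs]
  have hsurj : Function.Surjective (MvPolynomial.aeval (R := F) ![ψ.symm f, ψ.symm g]) := by
    have key : ∀ x ∈ Algebra.adjoin K {ub, f, g},
        ∃ q, MvPolynomial.aeval (R := F) ![ψ.symm f, ψ.symm g] q = ψ.symm x := by
      intro x hx
      induction hx using Algebra.adjoin_induction with
      | mem x hx =>
        rcases hx with rfl | rfl | rfl
        · obtain ⟨a, rfl⟩ := hU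
          exact ⟨MvPolynomial.C a, by simp⟩
        · exact ⟨MvPolynomial.X 0, by simp⟩
        · exact ⟨MvPolynomial.X 1, by simp⟩
      | algebraMap r =>
        obtain ⟨a, ha⟩ := hK r
        exact ⟨MvPolynomial.C a, by rw [← ha]; simp⟩
      | add x y _ _ hx hy =>
        obtain ⟨q, hq⟩ := hx
        obtain ⟨r, hr⟩ := hy
        exact ⟨q + r, by rw [map_add, hq, hr, map_add]⟩
      | mul x y _ _ hx hy =>
        obtain ⟨q, hq⟩ := hx
        obtain ⟨r, hr⟩ := hy
        exact ⟨q * r, by rw [map_mul, hq, hr, map_mul]⟩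
    intro m
    obtain ⟨q, hq⟩ := key _ (htop m)
    exact ⟨q, by rw [hq]; simp⟩
  have := irred_aux _ _ hsurj
  exact (MulEquiv.irreducible_iff ψ.symm).1 this

/-- The ideal `I_{c₁}^X` contains an element whose residue is a coordinate of
`(K[u]/(c₁))[p,s]` iff the residue of `h₁` is such a coordinate; moreover any such
element is, modulo `c₁`, a nonzero `K[u]/(c₁)`-scalar multiple of `h₁`. -/
theorem residual_coordinate_criterion {K : Type} [Field K] [CharZero K]
    (X : Derivation K (PolyR K) (PolyR K))
    (hln : LND K X) (hirr : IrredDer K X) (hrk : rankD K X = 2)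
    (u p : PolyR K) (hu : IsCoord K u)
    (hker : {a : PolyR K | X a = 0} = (Algebra.adjoin K {u, p} : Subalgebra K (PolyR K)))
    (s : PolyR K) (hs : IsMinLocalSlice K X s)
    (c c1 : Polynomial K) (hc : X s = Polynomial.aeval u c)
    (hc1 : Prime c1) (hc1c : c1 ∣ c)
    (d : ℕ) (a : Fin d → PolyR K) (h1 : PolyR K)
    (ha : ∀ i : Fin d, a i ∈ Algebra.adjoin K {u, p})
    (hmonic : h1 = s ^ d + ∑ i : Fin d, a i * s ^ (i : ℕ))
    (hgen : ∀ h : PolyR K,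
      (Polynomial.aeval u c1 ∣ h ∧ h ∈ Algebra.adjoin K {u, p, s}) ↔
      (∃ α ∈ Algebra.adjoin K {u, p, s}, ∃ β ∈ Algebra.adjoin K {u, p, s},
        h = α * Polynomial.aeval u c1 + β * h1)) :
    ∀ (uT pT sT h1T c1T : Algebra.adjoin K {u, p, s}),
      (uT : PolyR K) = u → (pT : PolyR K) = p → (sT : PolyR K) = s →
      (h1T : PolyR K) = h1 → (c1T : PolyR K) = Polynomial.aeval u c1 →
      ((∃ hT : Algebra.adjoin K {u, p, s}, Polynomial.aeval u c1 ∣ (hT : PolyR K) ∧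
          IsResidualCoord c1T uT pT sT (Ideal.Quotient.mk (Ideal.span {c1T}) hT)) ↔
        IsResidualCoord c1T uT pT sT (Ideal.Quotient.mk (Ideal.span {c1T}) h1T)) ∧
      ∀ hT : Algebra.adjoin K {u, p, s}, Polynomial.aeval u c1 ∣ (hT : PolyR K) →
        IsResidualCoord c1T uT pT sT (Ideal.Quotient.mk (Ideal.span {c1T}) hT) →
        ∃ μ : Polynomial K, ¬ c1 ∣ μ ∧
          ∀ μT : Algebra.adjoin K {u, p, s}, (μT : PolyR K) = Polynomial.aeval u μ →
            Ideal.Quotient.mk (Ideal.span {c1T}) hT =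
              Ideal.Quotient.mk (Ideal.span {c1T}) μT *
                Ideal.Quotient.mk (Ideal.span {c1T}) h1T := by
  intro uT pT sT h1T c1T hu' hp' hs' hh1 hc1T
  have hind := algIndep_aux X hln u p s hker hs.1
  have hval : ∀ q : Polynomial K,
      ((Polynomial.aeval uT q : Algebra.adjoin K {u, p, s}) : PolyR K) =
        Polynomial.aeval u q := by
    intro q
    have h := Polynomial.aeval_algHom_apply (Algebra.adjoin K {u, p, s}).val uT q
    rw [Subalgebra.coe_val, hu'] at h
    exact h.symm
  have hc1T' : c1T = Polynomial.aeval uT c1 := Subtype.ext (by rw [hc1T, hval])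
  obtain ⟨ψ, hψC, hψ0, hψ1⟩ := residue_aux u p s hind uT pT sT c1T hu' hp' hs' c1 hc1T'
  have hprime : (Ideal.span {c1}).IsPrime := (Ideal.span_singleton_prime hc1.ne_zero).2 hc1
  -- `c1(u)` is not a unit in `K[x,y,z]`
  have hnu : ¬ IsUnit (Polynomial.aeval u c1 : PolyR K) := by
    intro h
    obtain ⟨r, hr, hr'⟩ := MvPolynomial.isUnit_iff_eq_C_of_isReduced.1 h
    have htr : AlgebraicIndependent K (fun _ : Unit => u) :=
      hind.comp (fun _ : Unit => (none : Option (Fin 2))) (fun _ _ _ => rfl)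
    have htu : Transcendental K u := (algebraicIndependent_unique_type_iff).1 htr
    have : c1 = Polynomial.C r := by
      apply transcendental_iff_injective.1 htu
      rw [hr', Polynomial.aeval_C]
      rfl
    exact hc1.not_isUnit (this ▸ Polynomial.isUnit_C.2 hr)
  -- `h1` is not a unit modulo `c1`
  have hh1nu : ¬ IsUnit (Ideal.Quotient.mk (Ideal.span {c1T}) h1T) := by
    intro h
    obtain ⟨w, hw⟩ := h.exists_right_inv
    obtain ⟨w, rfl⟩ := Ideal.Quotient.mk_surjective w
    rw [← map_mul, ← map_one (Ideal.Quotient.mk (Ideal.span {c1T})), Ideal.Quotient.eq,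
      Ideal.mem_span_singleton] at hw
    obtain ⟨t, ht⟩ := hw
    have ht' := congrArg Subtype.val ht
    simp only [AddSubgroupClass.coe_sub, MulMemClass.coe_mul, OneMemClass.coe_one, hh1, hc1T]
      at ht'
    have := (hgen 1).2 ⟨-(t : PolyR K), Subalgebra.neg_mem _ t.2, w, w.2, by
      linear_combination -ht'⟩
    exact hnu (isUnit_of_dvd_one this.1)
  have main : ∀ hT : Algebra.adjoin K {u, p, s}, Polynomial.aeval u c1 ∣ (hT : PolyR K) →
      IsResidualCoord c1T uT pT sT (Ideal.Quotient.mk (Ideal.span {c1T}) hT) →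
      ∃ μ ν : Polynomial K, ¬ c1 ∣ μ ∧
        Ideal.Quotient.mk (Ideal.span {c1T}) hT =
          Ideal.Quotient.mk (Ideal.span {c1T}) (Polynomial.aeval uT μ) *
            Ideal.Quotient.mk (Ideal.span {c1T}) h1T ∧
        Ideal.Quotient.mk (Ideal.span {c1T}) h1T =
          Ideal.Quotient.mk (Ideal.span {c1T}) (Polynomial.aeval uT ν) *
            Ideal.Quotient.mk (Ideal.span {c1T}) hT := by
    rintro hT hdvd ⟨g, hg⟩
    have hirrf : Irreducible (Ideal.Quotient.mk (Ideal.span {c1T}) hT) := by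
      refine resirred_aux ψ _ g _ _ _ (fun r => ⟨Ideal.Quotient.mk _ (Polynomial.C r), ?_⟩)
        ⟨Ideal.Quotient.mk _ Polynomial.X, ?_⟩ ?_ hψ0 hψ1 hg
      · rw [hψC, Polynomial.aeval_C]; rfl
      · rw [hψC, Polynomial.aeval_X]
      · intro a
        obtain ⟨q, rfl⟩ := Ideal.Quotient.mk_surjective a
        rw [hψC]
        have : Ideal.Quotient.mk (Ideal.span {c1T}) (Polynomial.aeval uT q) =
            Polynomial.aeval (Ideal.Quotient.mk (Ideal.span {c1T}) uT) q :=
          (Polynomial.aeval_algHom_apply (Ideal.Quotient.mkₐ K (Ideal.span {c1T})) uT q).symm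
        rw [this]
        exact Polynomial.aeval_mem_adjoin_singleton _ _
    obtain ⟨α, hα, β, hβ, hab⟩ := (hgen hT).1 ⟨hdvd, hT.2⟩
    have hfac : Ideal.Quotient.mk (Ideal.span {c1T}) hT =
        Ideal.Quotient.mk (Ideal.span {c1T}) ⟨β, hβ⟩ *
          Ideal.Quotient.mk (Ideal.span {c1T}) h1T := by
      rw [← map_mul, Ideal.Quotient.eq, Ideal.mem_span_singleton]
      refine ⟨⟨α, hα⟩, Subtype.ext ?_⟩
      simp only [AddSubgroupClass.coe_sub, MulMemClass.coe_mul, hh1, hc1T, hab]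
      ring
    have hβu : IsUnit (Ideal.Quotient.mk (Ideal.span {c1T}) ⟨β, hβ⟩) :=
      (hirrf.isUnit_or_isUnit hfac).resolve_right hh1nu
    have hβu' := hβu.map ψ.symm
    obtain ⟨m, hm, hm'⟩ := MvPolynomial.isUnit_iff_eq_C_of_isReduced.1 hβu'
    obtain ⟨n, hn⟩ := hm.exists_right_inv
    obtain ⟨μ, rfl⟩ := Ideal.Quotient.mk_surjective m
    obtain ⟨ν, rfl⟩ := Ideal.Quotient.mk_surjective n
    have hβμ : Ideal.Quotient.mk (Ideal.span {c1T}) ⟨β, hβ⟩ =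
        Ideal.Quotient.mk (Ideal.span {c1T}) (Polynomial.aeval uT μ) := by
      rw [← hψC, ← hm', RingEquiv.apply_symm_apply]
    refine ⟨μ, ν, ?_, ?_, ?_⟩
    · intro hd
      rw [Ideal.Quotient.eq_zero_iff_mem.2 (Ideal.mem_span_singleton.2 hd)] at hm
      exact not_isUnit_zero hm
    · rw [hfac, hβμ]
    · rw [hfac, hβμ, ← hψC, ← hψC, ← mul_assoc, ← map_mul, ← map_mul, mul_comm
        (Ideal.Quotient.mk _ ν), hn, map_one, map_one, one_mul]
  refine ⟨⟨?_, ?_⟩, ?_⟩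
  · rintro ⟨hT, hd, hres⟩
    obtain ⟨μ, ν, -, h1, h2⟩ := main hT hd hres
    obtain ⟨g, hg⟩ := hres
    refine ⟨g, ?_⟩
    rw [← hg]
    have hmem : ∀ (q : Polynomial K) (S : Set (↥(Algebra.adjoin K {u, p, s}) ⧸
        Ideal.span {c1T})), Ideal.Quotient.mk (Ideal.span {c1T}) uT ∈ S →
        Ideal.Quotient.mk (Ideal.span {c1T}) (Polynomial.aeval uT q) ∈ Algebra.adjoin K S := by
      intro q S hS
      have : Ideal.Quotient.mk (Ideal.span {c1T}) (Polynomial.aeval uT q) =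
          Polynomial.aeval (Ideal.Quotient.mk (Ideal.span {c1T}) uT) q :=
        (Polynomial.aeval_algHom_apply (Ideal.Quotient.mkₐ K (Ideal.span {c1T})) uT q).symm
      rw [this]
      exact Algebra.adjoin_mono (Set.singleton_subset_iff.2 hS)
        (Polynomial.aeval_mem_adjoin_singleton _ _)
    apply le_antisymm
    · apply Algebra.adjoin_le
      rintro x (rfl | rfl | rfl)
      · exact Algebra.subset_adjoin (by simp)
      · rw [h2]
        exact Subalgebra.mul_mem _ (hmem _ _ (by simp)) (Algebra.subset_adjoin (by simp))
      · exact Algebra.subset_adjoin (by simp)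
    · apply Algebra.adjoin_le
      rintro x (rfl | rfl | rfl)
      · exact Algebra.subset_adjoin (by simp)
      · rw [h1]
        exact Subalgebra.mul_mem _ (hmem _ _ (by simp)) (Algebra.subset_adjoin (by simp))
      · exact Algebra.subset_adjoin (by simp)
  · intro h
    refine ⟨h1T, ?_, h⟩
    rw [hh1]
    exact ((hgen h1).2 ⟨0, Subalgebra.zero_mem _, 1, Subalgebra.one_mem _, by ring⟩).1
  · intro hT hd hres
    obtain ⟨μ, ν, hμ, h1, -⟩ := main hT hd hres
    refine ⟨μ, hμ, fun μT hμT => ?_⟩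
    rw [h1, show μT = Polynomial.aeval uT μ from Subtype.ext (by rw [hμT, hval])]

end
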